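/- Multiplying a permutation h of cycle type μ in S_d by the sum of all transpositions yields: for each i < j, exactly ij·mᵢ(μ)mⱼ(μ) of the resulting products are obtained by joining an i-cycle and a j-cycle of h into an (i+j)-cycle, exactly i²mᵢ(μ)(mᵢ(μ)-1)/2 by joining two i-cycles into a 2i-cycle, exactly (i+j)m_{i+j}(μ) (for i < j) by cutting an (i+j)-cycle into an i-cycle and a j-cycle, and exactly i·m_{2i}(μ) by cutting a 2i-cycle into two i-cycles. -/

import Mathlib

/-- The full cycle type of a permutation of `Fin d` (including parts equal to 1 for the
fixed points), as a partition of `d`. -/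
def fullCT (d : ℕ) (g : Equiv.Perm (Fin d)) : Multiset ℕ :=
  g.cycleType + Multiset.replicate (d - g.cycleType.sum) 1

open Finset Function Equiv

section PointPeriods

variable {α : Type*} [Fintype α] [DecidableEq α]

theorem Equiv.Perm.minimalPeriod_pos {β : Type*} [Fintype β] (h : Perm β) (x : β) :
    0 < minimalPeriod h x :=
  minimalPeriod_pos_of_mem_periodicPts (h.injective.mem_periodicPts x)

theorem Equiv.Perm.sameCycle_iterate {β : Type*} (h : Perm β) (a : β) (n : ℕ) :
    h.SameCycle a (h^[n] a) :=
  ⟨n, by rw [zpow_natCast, Perm.iterate_eq_pow]⟩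

theorem Equiv.Perm.SameCycle.exists_iterate_eq {β : Type*} [Fintype β] {h : Perm β}
    {a b : β} (hab : h.SameCycle a b) :
    ∃ n < minimalPeriod h a, h^[n] a = b := by
  obtain ⟨n, rfl⟩ := hab.exists_nat_pow_eq
  refine ⟨n % minimalPeriod h a, Nat.mod_lt _ (h.minimalPeriod_pos a), ?_⟩
  rw [iterate_mod_minimalPeriod_eq, Perm.iterate_eq_pow]

theorem Equiv.Perm.SameCycle.minimalPeriod_eq {β : Type*} [Fintype β] {h : Perm β}
    {a b : β} (hab : h.SameCycle a b) :
    minimalPeriod h b = minimalPeriod h a := by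
  obtain ⟨n, -, rfl⟩ := hab.exists_iterate_eq
  exact minimalPeriod_apply_iterate (h.injective.mem_periodicPts a) n

theorem Equiv.Perm.filter_sameCycle_eq_image (h : Perm α) (a : α) :
    ({x | h.SameCycle a x} : Finset α) = (range (minimalPeriod h a)).image (h^[·] a) := by
  ext x
  simp only [mem_filter_univ, mem_image, mem_range]
  constructor
  · exact fun hx ↦ hx.exists_iterate_eq
  · rintro ⟨n, -, rfl⟩
    exact h.sameCycle_iterate a n

theorem Equiv.Perm.card_filter_sameCycle_and (h : Perm α) (a : α) (P : α → Prop)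
    [DecidablePred P] :
    #{x | h.SameCycle a x ∧ P x} = #{n ∈ range (minimalPeriod h a) | P (h^[n] a)} := by
  rw [← filter_filter, h.filter_sameCycle_eq_image, filter_image, card_image_of_injOn]
  refine iterate_injOn_Iio_minimalPeriod.mono fun n hn ↦ ?_
  simp only [coe_filter, mem_range, Set.mem_ofPred_eq] at hn
  exact hn.1

theorem Equiv.Perm.card_filter_sameCycle (h : Perm α) (a : α) :
    #{x | h.SameCycle a x} = minimalPeriod h a := by
  simpa using h.card_filter_sameCycle_and a (fun _ ↦ True)

theorem Equiv.Perm.mul_count_parts_partition (h : Perm α) (m : ℕ) :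
    m * h.partition.parts.count m = #{x | minimalPeriod h x = m} := by
  rcases Nat.lt_trichotomy m 1 with hm | rfl | hm
  · obtain rfl : m = 0 := by omega
    simp [(h.minimalPeriod_pos _).ne']
  · have h1 : h.cycleType.count 1 = 0 :=
      Multiset.count_eq_zero.2 fun hh ↦ absurd (Perm.one_lt_of_mem_cycleType hh) (by simp)
    rw [Perm.parts_partition, Multiset.count_add, h1, Multiset.count_replicate_self, zero_add,
      one_mul, ← card_compl]
    congr 1
    ext x
    simp [minimalPeriod_eq_one_iff_isFixedPt, IsFixedPt]
  · have h1 : ∀ x, h x ≠ x → (h.cycleOf x).support = ({y | h.SameCycle x y} : Finset α) := by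
      intro x hx
      ext y
      rw [Perm.mem_support_cycleOf_iff' hx, mem_filter_univ]
    rw [Perm.parts_partition, Multiset.count_add, Multiset.count_replicate, if_neg (by omega),
      add_zero, Perm.cycleType_def, Multiset.count_map, card_eq_sum_card_fiberwise
        (f := fun x ↦ h.cycleOf x) (t := {c ∈ h.cycleFactorsFinset | m = #c.support})]
    · rw [sum_const_nat (m := m), mul_comm]
      · rfl
      · intro c hc
        rw [mem_filter] at hc
        rw [hc.2]
        congr 1
        ext x
        have h2 := Perm.eq_cycleOf_of_mem_cycleFactorsFinset_iff h c hc.1 x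
        rw [← h2, mem_filter, mem_filter_univ]
        refine ⟨fun hh ↦ hh.2.symm, fun hh ↦ ⟨?_, hh.symm⟩⟩
        have hx : h x ≠ x := by
          rw [← Perm.cycleOf_mem_cycleFactorsFinset_iff.trans Perm.mem_support, ← hh]
          exact hc.1
        rw [hh, h1 x hx, h.card_filter_sameCycle]
    · intro x hx
      simp only [coe_filter, mem_univ, true_and, Set.mem_ofPred_eq] at hx ⊢
      have hx' : h x ≠ x := fun hh ↦ by
        have := minimalPeriod_eq_one_iff_isFixedPt.2 hh
        omega
      rw [h1 x hx', h.card_filter_sameCycle, hx, Perm.cycleOf_mem_cycleFactorsFinset_iff,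
        Perm.mem_support]
      exact ⟨hx', rfl⟩

theorem iterate_eq_iterate_of_forall_lt {β : Type*} {f g : β → β} {x : β} {n : ℕ}
    (H : ∀ m < n, g (f^[m] x) = f (f^[m] x)) : g^[n] x = f^[n] x := by
  induction n with
  | zero => rfl
  | succ n ih =>
    rw [iterate_succ_apply', iterate_succ_apply', ih fun m hm ↦ H m (by omega), H n (by omega)]

theorem minimalPeriod_eq_of_forall_lt_ne {β : Type*} {f : β → β} {x : β} {n : ℕ} (hn : 0 < n)
    (hx : f^[n] x = x) (H : ∀ m < n, 0 < m → f^[m] x ≠ x) : minimalPeriod f x = n := by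
  refine le_antisymm (IsPeriodicPt.minimalPeriod_le hn hx) ?_
  by_contra! hlt
  exact H _ hlt (minimalPeriod_pos_of_mem_periodicPts ⟨n, hn, hx⟩) iterate_minimalPeriod

/-- As long as the `h`-orbit of `x` avoids `a` and `b`, multiplying `h` by `swap a b` does not
change it. -/
theorem Equiv.Perm.swap_mul_iterate_of_lt {β : Type*} [DecidableEq β] {h : Perm β} {a b x : β}
    {n : ℕ} (ha : ∀ m < n, 0 < m → h^[m] x ≠ a) (hb : ∀ m < n, 0 < m → h^[m] x ≠ b) {m : ℕ}
    (hm : m < n) : (swap a b * h)^[m] x = h^[m] x := by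
  refine iterate_eq_iterate_of_forall_lt fun l hl ↦ ?_
  rw [Perm.mul_apply, ← iterate_succ_apply' h]
  exact swap_apply_of_ne_of_ne (ha _ (by omega) (by omega)) (hb _ (by omega) (by omega))

/-- If the `h`-orbit of `x` avoids `a` and `b` before step `n`, then multiplying `h` by `swap a b`
swaps `a` and `b` at step `n`. -/
theorem Equiv.Perm.swap_mul_iterate {β : Type*} [DecidableEq β] {h : Perm β} {a b x : β}
    {n : ℕ} (hn : 0 < n)
    (ha : ∀ m < n, 0 < m → h^[m] x ≠ a) (hb : ∀ m < n, 0 < m → h^[m] x ≠ b) :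
    (swap a b * h)^[n] x = swap a b (h^[n] x) := by
  obtain ⟨n, rfl⟩ := Nat.exists_eq_add_of_lt hn
  rw [zero_add] at *
  rw [iterate_succ_apply', swap_mul_iterate_of_lt ha hb (Nat.lt_succ_self n), Perm.mul_apply,
    ← iterate_succ_apply' h]

/-- Multiplying `h` by `swap a (h^[k] a)` cuts the cycle of `a`, of length `p > k`, into cycles of
lengths `k` and `p - k`. -/
theorem Equiv.Perm.parts_partition_swap_mul_of_iterate {h : Perm α} {a : α} {k : ℕ} (hk : 0 < k)
    (hkp : k < minimalPeriod h a) :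
    (swap a (h^[k] a) * h).partition.parts + {minimalPeriod h a} =
      h.partition.parts + {k, minimalPeriod h a - k} := by
  set b := h^[k] a with hb
  set g := swap a b * h with hg
  set p := minimalPeriod h a with hp
  have inj : ∀ m < p, ∀ n < p, h^[m] a = h^[n] a → m = n := fun m hm n hn e ↦
    iterate_injOn_Iio_minimalPeriod hm hn e
  have hap : h^[p] a = a := iterate_minimalPeriod
  have hbi : ∀ n, h^[n] b = h^[n + k] a := fun n ↦ (iterate_add_apply _ _ _ _).symm
  have haa : ∀ m < k, 0 < m → h^[m] a ≠ a := fun m hm h0 e ↦ by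
    have := inj m (by omega) 0 (by omega) e
    omega
  have hab : ∀ m < k, 0 < m → h^[m] a ≠ b := fun m hm h0 e ↦ by
    have := inj m (by omega) k (by omega) e
    omega
  have hba : ∀ m < p - k, 0 < m → h^[m] b ≠ a := fun m hm h0 e ↦ by
    have := inj (m + k) (by omega) 0 (by omega) (hbi m ▸ e)
    omega
  have hbb : ∀ m < p - k, 0 < m → h^[m] b ≠ b := fun m hm h0 e ↦ by
    have := inj (m + k) (by omega) k (by omega) (hbi m ▸ e)
    omega
  have hga : minimalPeriod g a = k := by
    refine minimalPeriod_eq_of_forall_lt_ne hk ?_ fun m hm h0 ↦ ?_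
    · rw [hg, swap_mul_iterate hk haa hab, ← hb, swap_apply_right]
    · rw [hg, swap_mul_iterate_of_lt haa hab hm]
      exact haa m hm h0
  have hgb : minimalPeriod g b = p - k := by
    refine minimalPeriod_eq_of_forall_lt_ne (by omega) ?_ fun m hm h0 ↦ ?_
    · rw [hg, swap_mul_iterate (by omega) hba hbb, hbi, Nat.sub_add_cancel hkp.le, hap,
        swap_apply_left]
    · rw [hg, swap_mul_iterate_of_lt hba hbb hm]
      exact hbb m hm h0
  have hgp : ∀ n < p, minimalPeriod g (h^[n] a) = if n < k then k else p - k := by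
    intro n hn
    split_ifs with hnk
    · rw [← swap_mul_iterate_of_lt haa hab hnk,
        minimalPeriod_apply_iterate (g.injective.mem_periodicPts a), hga]
    · obtain ⟨l, rfl⟩ := Nat.exists_eq_add_of_le' (not_lt.1 hnk)
      rw [← hbi, ← swap_mul_iterate_of_lt hba hbb (show l < p - k by omega),
        minimalPeriod_apply_iterate (g.injective.mem_periodicPts b), hgb]
  have hout : ∀ x, ¬ h.SameCycle a x → minimalPeriod g x = minimalPeriod h x := by
    intro x hx
    have hx' : ∀ n, g^[n] x = h^[n] x := fun n ↦ by
      refine swap_mul_iterate_of_lt (n := n + 1) (fun m _ _ e ↦ hx ?_) (fun m _ _ e ↦ hx ?_)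
        (Nat.lt_succ_self n)
      · exact (e ▸ h.sameCycle_iterate x m).symm
      · exact (h.sameCycle_iterate a k).trans (hb ▸ e ▸ h.sameCycle_iterate x m).symm
    rw [minimalPeriod_eq_minimalPeriod_iff]
    intro n
    rw [IsPeriodicPt, IsPeriodicPt, IsFixedPt, IsFixedPt, hx']
  ext m
  rcases Nat.eq_zero_or_pos m with rfl | hm
  · have h0 : ∀ f : Perm α, f.partition.parts.count 0 = 0 := fun f ↦
      Multiset.count_eq_zero.2 fun hh ↦ (f.partition.parts_pos hh).ne' rfl
    rw [Multiset.count_add, Multiset.count_add, h0, h0]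
    simp only [Multiset.insert_eq_cons, Multiset.count_cons, Multiset.count_singleton]
    grind
  · have split : ∀ f : Perm α, #{x | minimalPeriod f x = m} =
        #{x | h.SameCycle a x ∧ minimalPeriod f x = m} +
          #{x | ¬ h.SameCycle a x ∧ minimalPeriod f x = m} := fun f ↦ by
      rw [← card_filter_add_card_filter_not (s := {x | minimalPeriod f x = m})
        (fun x ↦ h.SameCycle a x), filter_filter, filter_filter]
      simp only [and_comm]
    have hcompl : #{x | ¬ h.SameCycle a x ∧ minimalPeriod g x = m} =
        #{x | ¬ h.SameCycle a x ∧ minimalPeriod h x = m} := by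
      congr 1
      ext x
      simp only [mem_filter_univ]
      exact and_congr_right fun hx ↦ by rw [hout x hx]
    have hh : #{x | h.SameCycle a x ∧ minimalPeriod h x = m} = if p = m then p else 0 := by
      have : ({x | h.SameCycle a x ∧ minimalPeriod h x = m} : Finset α) =
          ({x | h.SameCycle a x ∧ p = m} : Finset α) := by
        ext x
        simp only [mem_filter_univ]
        exact and_congr_right fun hx ↦ by rw [hx.minimalPeriod_eq]
      rw [this]
      split_ifs with hpm
      · simp only [hpm, and_true]
        rw [h.card_filter_sameCycle, ← hpm]
      · simp [hpm]
    have hgc : #{x | h.SameCycle a x ∧ minimalPeriod g x = m} =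
        (if k = m then k else 0) + if p - k = m then p - k else 0 := by
      rw [h.card_filter_sameCycle_and, ← hp, card_filter]
      obtain ⟨q, hq⟩ := Nat.exists_eq_add_of_lt hkp
      have hq' : p = k + (p - k) := by omega
      rw [sum_congr rfl fun n hn ↦ by rw [hgp n (mem_range.1 hn)]]
      conv_lhs => rw [hq', sum_range_add]
      congr 1
      · rw [sum_congr rfl fun n hn ↦ by rw [if_pos (mem_range.1 hn)]]
        simp
      · simp
    have key := split g
    rw [hcompl, hgc, ← mul_count_parts_partition] at key
    have key' := split h
    rw [hh, ← mul_count_parts_partition] at key'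
    apply Nat.eq_of_mul_eq_mul_left hm
    simp only [Multiset.insert_eq_cons, Multiset.count_add, Multiset.count_cons,
      Multiset.count_singleton, mul_add]
    grind

/-- Multiplying `h` by `swap a b` joins the cycles of `a` and `b` if these are distinct. -/
theorem Equiv.Perm.parts_partition_swap_mul_of_not_sameCycle {h : Perm α} {a b : α}
    (hab : ¬ h.SameCycle a b) :
    (swap a b * h).partition.parts + {minimalPeriod h a, minimalPeriod h b} =
      h.partition.parts + {minimalPeriod h a + minimalPeriod h b} := by
  set g := swap a b * h with hg
  set p := minimalPeriod h a with hp
  set q := minimalPeriod h b with hq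
  have hp0 : 0 < p := h.minimalPeriod_pos a
  have hq0 : 0 < q := h.minimalPeriod_pos b
  have haa : ∀ m < p, 0 < m → h^[m] a ≠ a := fun m hm h0 e ↦
    not_isPeriodicPt_of_pos_of_lt_minimalPeriod h0.ne' hm e
  have hbb : ∀ m < q, 0 < m → h^[m] b ≠ b := fun m hm h0 e ↦
    not_isPeriodicPt_of_pos_of_lt_minimalPeriod h0.ne' hm e
  have hanb : ∀ m, h^[m] a ≠ b := fun m e ↦ hab (e ▸ h.sameCycle_iterate a m)
  have hbna : ∀ m, h^[m] b ≠ a := fun m e ↦ hab (e ▸ h.sameCycle_iterate b m).symm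
  have hgp : g^[p] a = b := by
    rw [hg, swap_mul_iterate hp0 haa fun m _ _ ↦ hanb m, hp, iterate_minimalPeriod,
      swap_apply_left]
  have hgq : g^[q] b = a := by
    rw [hg, swap_mul_iterate hq0 (fun m _ _ ↦ hbna m) hbb, hq, iterate_minimalPeriod,
      swap_apply_right]
  have hga : minimalPeriod g a = p + q := by
    refine minimalPeriod_eq_of_forall_lt_ne (by omega) ?_ fun m hm h0 ↦ ?_
    · rw [add_comm, iterate_add_apply, hgp, hgq]
    · rcases lt_or_ge m p with hmp | hmp
      · rw [hg, swap_mul_iterate_of_lt haa (fun m _ _ ↦ hanb m) hmp]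
        exact haa m hmp h0
      · obtain ⟨l, rfl⟩ := Nat.exists_eq_add_of_le' hmp
        rw [iterate_add_apply, hgp, hg,
          swap_mul_iterate_of_lt (fun m _ _ ↦ hbna m) hbb (show l < q by omega)]
        exact hbna l
  have key := parts_partition_swap_mul_of_iterate (h := g) (a := a) hp0 (by omega)
  rw [hgp, hga, hg, swap_mul_self_mul, Nat.add_sub_cancel_left] at key
  exact key.symm

end PointPeriods

theorem Multiset.eq_sub_add_iff_add_eq_add {M N s t : Multiset ℕ} (hs : ∀ x ∈ s, 0 < x)
    (hMN : N.sum = M.sum) (hst : s.sum = t.sum) (hd : Disjoint s t) :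
    N = M - s + t ↔ N + s = M + t := by
  constructor
  · intro hN
    have h1 : M - s + s = M + (s - M) := by
      ext x
      simp only [count_add, count_sub]
      omega
    have h2 : (s - M).sum = 0 := by
      have h3 := congrArg sum h1
      rw [hN, sum_add] at hMN
      simp only [sum_add] at h3
      omega
    have h4 : s - M = 0 := by
      refine eq_zero_of_forall_notMem fun x hx ↦ ?_
      have h5 := sum_eq_zero_iff.1 h2 x hx
      exact (hs x (mem_of_le tsub_le_self hx)).ne' h5
    rw [h4, add_zero] at h1
    rw [hN, add_right_comm, h1]
  · intro hN
    ext x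
    have h1 := congrArg (count x) hN
    have h2 : count x s = 0 ∨ count x t = 0 := by
      by_contra! h3
      exact disjoint_left.1 hd (count_ne_zero.1 h3.1) (count_ne_zero.1 h3.2)
    simp only [count_add, count_sub] at h1 ⊢
    omega

section Counting

variable {α : Type*} [Fintype α] [DecidableEq α]

theorem Equiv.Perm.two_mul_card_isSwap (P : Perm α → Prop) :
    2 * Nat.card {t : Perm α // t.IsSwap ∧ P t} =
      Nat.card {ab : α × α // ab.1 ≠ ab.2 ∧ P (swap ab.1 ab.2)} := by
  classical
  rw [Nat.card_eq_fintype_card, Nat.card_eq_fintype_card, Fintype.card_subtype,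
    Fintype.card_subtype]
  rw [card_eq_sum_card_fiberwise (f := fun ab : α × α ↦ swap ab.1 ab.2)
    (t := {t : Perm α | t.IsSwap ∧ P t})]
  · rw [sum_const_nat (m := 2), mul_comm]
    intro t ht
    rw [mem_filter_univ] at ht
    obtain ⟨⟨a, b, hab, rfl⟩, hP⟩ := ht
    have : ({ab ∈ ({ab : α × α | ab.1 ≠ ab.2 ∧ P (swap ab.1 ab.2)} : Finset (α × α)) |
        swap ab.1 ab.2 = swap a b} : Finset (α × α)) = {(a, b), (b, a)} := by
      ext ⟨c, e⟩
      simp only [mem_filter, mem_univ, true_and, mem_insert, mem_singleton, Prod.mk.injEq]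
      constructor
      · rintro ⟨⟨hce, -⟩, he⟩
        have h1 := swap_apply_left c e
        have h2 := swap_apply_right c e
        rw [he] at h1 h2
        grind
      · rintro (⟨rfl, rfl⟩ | ⟨rfl, rfl⟩)
        · exact ⟨⟨hab, hP⟩, rfl⟩
        · rw [swap_comm]
          exact ⟨⟨hab.symm, hP⟩, rfl⟩
    rw [this, card_pair]
    simp [hab]
  · intro ab h
    simp only [coe_filter, mem_univ, true_and, Set.mem_ofPred_eq] at h ⊢
    exact ⟨⟨_, _, h.1, rfl⟩, h.2⟩

theorem Equiv.Perm.isSwap_join_iff {h : Perm α} {i j : ℕ} (hi : 0 < i) (hj : 0 < j) {a b : α}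
    (hab : a ≠ b) :
    (swap a b * h).partition.parts = h.partition.parts - {i, j} + {i + j} ↔
      ¬ h.SameCycle a b ∧ (minimalPeriod h a = i ∧ minimalPeriod h b = j ∨
        minimalPeriod h a = j ∧ minimalPeriod h b = i) := by
  have hp := h.minimalPeriod_pos a
  have hq := h.minimalPeriod_pos b
  rw [Multiset.eq_sub_add_iff_add_eq_add (by simp [hi, hj])
    (by rw [(swap a b * h).partition.parts_sum, h.partition.parts_sum]) (by simp)
    (by simp; omega)]
  by_cases hs : h.SameCycle a b
  · obtain ⟨k, hk, rfl⟩ := hs.exists_iterate_eq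
    have hk0 : 0 < k := Nat.pos_of_ne_zero fun h0 ↦ hab (by rw [h0]; rfl)
    have key := congrArg Multiset.card (parts_partition_swap_mul_of_iterate hk0 hk)
    refine iff_of_false (fun H ↦ ?_) fun H ↦ H.1 hs
    have H := congrArg Multiset.card H
    simp at H key
    omega
  · have key := parts_partition_swap_mul_of_not_sameCycle hs
    set p := minimalPeriod h a
    set q := minimalPeriod h b
    simp only [hs, not_false_eq_true, true_and]
    constructor
    · intro H
      have H2 : ({i, j} : Multiset ℕ) + {p + q} = {p, q} + {i + j} := by
        apply add_left_cancel (a := (swap a b * h).partition.parts + h.partition.parts)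
        calc _ = ((swap a b * h).partition.parts + {i, j}) +
              (h.partition.parts + {p + q}) := by abel
          _ = _ := by rw [H, ← key]; abel
      have c1 : i + j ∈ ({i, j} : Multiset ℕ) + {p + q} := by rw [H2]; simp
      have c2 : p ∈ ({i, j} : Multiset ℕ) + {p + q} := by rw [H2]; simp
      simp at c1 c2
      omega
    · rintro (⟨h1, h2⟩ | ⟨h1, h2⟩)
      · rw [← h1, ← h2, key]
      · rw [← h1, ← h2, Multiset.pair_comm, key, add_comm q p]

theorem Equiv.Perm.isSwap_cut_iff {h : Perm α} {i j : ℕ} (hi : 0 < i) (hj : 0 < j) {a b : α}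
    (hab : a ≠ b) :
    (swap a b * h).partition.parts = h.partition.parts - {i + j} + {i, j} ↔
      minimalPeriod h a = i + j ∧ (b = h^[i] a ∨ b = h^[j] a) := by
  rw [Multiset.eq_sub_add_iff_add_eq_add (by simp; omega)
    (by rw [(swap a b * h).partition.parts_sum, h.partition.parts_sum]) (by simp)
    (by simp; omega)]
  by_cases hs : h.SameCycle a b
  · obtain ⟨k, hk, rfl⟩ := hs.exists_iterate_eq
    have hk0 : 0 < k := Nat.pos_of_ne_zero fun h0 ↦ hab (by rw [h0]; rfl)
    have key := parts_partition_swap_mul_of_iterate hk0 hk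
    constructor
    · intro H
      set p := minimalPeriod h a
      have H2 : ({i + j} : Multiset ℕ) + {k, p - k} = {p} + {i, j} := by
        apply add_left_cancel
          (a := (swap a (h^[k] a) * h).partition.parts + h.partition.parts)
        calc _ = ((swap a (h^[k] a) * h).partition.parts + {i + j}) +
              (h.partition.parts + {k, p - k}) := by abel
          _ = _ := by rw [H, ← key]; abel
      have c1 : i + j ∈ ({p} : Multiset ℕ) + {i, j} := by rw [← H2]; simp
      have c2 : k ∈ ({p} : Multiset ℕ) + {i, j} := by rw [← H2]; simp
      simp only [Multiset.insert_eq_cons, Multiset.mem_add, Multiset.mem_cons,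
        Multiset.mem_singleton] at c1 c2
      have hp : p = i + j := by omega
      refine ⟨hp, ?_⟩
      rcases c2 with c | c | c
      · exact absurd c hk.ne
      · exact Or.inl (by rw [c])
      · exact Or.inr (by rw [c])
    · rintro ⟨h1, h2⟩
      have hkij : k = i ∨ k = j := by
        refine h2.imp (fun e ↦ ?_) fun e ↦ ?_ <;>
        exact iterate_injOn_Iio_minimalPeriod hk (Set.mem_Iio.2 (by omega)) e
      rw [← h1, key, h1]
      rcases hkij with rfl | rfl
      · rw [Nat.add_sub_cancel_left]
      · rw [Nat.add_sub_cancel, Multiset.pair_comm]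
  · have key := congrArg Multiset.card (parts_partition_swap_mul_of_not_sameCycle hs)
    refine iff_of_false (fun H ↦ ?_) ?_
    · have H := congrArg Multiset.card H
      simp at H key
      omega
    · rintro ⟨-, rfl | rfl⟩ <;> exact hs (h.sameCycle_iterate a _)

theorem Equiv.Perm.two_mul_card_isSwap_join (h : Perm α) {i j : ℕ} (hi : 0 < i) (hj : 0 < j) :
    2 * Nat.card {t : Perm α // t.IsSwap ∧
        (t * h).partition.parts = h.partition.parts - {i, j} + {i + j}} =
      #{ab : α × α | ¬ h.SameCycle ab.1 ab.2 ∧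
        (minimalPeriod h ab.1 = i ∧ minimalPeriod h ab.2 = j ∨
          minimalPeriod h ab.1 = j ∧ minimalPeriod h ab.2 = i)} := by
  rw [two_mul_card_isSwap fun t : Perm α ↦
    (t * h).partition.parts = h.partition.parts - {i, j} + {i + j}, Nat.card_eq_fintype_card,
    Fintype.card_subtype]
  congr 1
  ext ⟨a, b⟩
  simp only [mem_filter_univ]
  constructor
  · rintro ⟨hab, H⟩
    exact (isSwap_join_iff hi hj hab).1 H
  · intro H
    have hab : a ≠ b := fun e ↦ H.1 (e ▸ SameCycle.refl h a)
    exact ⟨hab, (isSwap_join_iff hi hj hab).2 H⟩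

theorem Equiv.Perm.two_mul_card_isSwap_cut (h : Perm α) {i j : ℕ} (hi : 0 < i) (hj : 0 < j) :
    2 * Nat.card {t : Perm α // t.IsSwap ∧
        (t * h).partition.parts = h.partition.parts - {i + j} + {i, j}} =
      #{ab : α × α | minimalPeriod h ab.1 = i + j ∧ (ab.2 = h^[i] ab.1 ∨ ab.2 = h^[j] ab.1)} := by
  rw [two_mul_card_isSwap fun t : Perm α ↦
    (t * h).partition.parts = h.partition.parts - {i + j} + {i, j}, Nat.card_eq_fintype_card,
    Fintype.card_subtype]
  congr 1
  ext ⟨a, b⟩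
  simp only [mem_filter_univ]
  constructor
  · rintro ⟨hab, H⟩
    exact (isSwap_cut_iff hi hj hab).1 H
  · intro H
    have hab : a ≠ b := by
      rintro rfl
      rcases H.2 with e | e
      · exact not_isPeriodicPt_of_pos_of_lt_minimalPeriod hi.ne' (by omega) e.symm
      · exact not_isPeriodicPt_of_pos_of_lt_minimalPeriod hj.ne' (by omega) e.symm
    exact ⟨hab, (isSwap_cut_iff hi hj hab).2 H⟩

theorem Equiv.Perm.card_isSwap_join_of_ne (h : Perm α) {i j : ℕ} (hi : 0 < i) (hj : 0 < j)
    (hij : i ≠ j) :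
    Nat.card {t : Perm α // t.IsSwap ∧
        (t * h).partition.parts = h.partition.parts - {i, j} + {i + j}} =
      i * j * h.partition.parts.count i * h.partition.parts.count j := by
  have key := h.two_mul_card_isSwap_join hi hj
  set S : ℕ → Finset α := fun m ↦ {x | minimalPeriod h x = m}
  have hS : ({ab : α × α | ¬ h.SameCycle ab.1 ab.2 ∧
        (minimalPeriod h ab.1 = i ∧ minimalPeriod h ab.2 = j ∨
          minimalPeriod h ab.1 = j ∧ minimalPeriod h ab.2 = i)} : Finset (α × α)) =
      S i ×ˢ S j ∪ S j ×ˢ S i := by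
    ext ⟨a, b⟩
    simp only [S, mem_filter_univ, mem_union, mem_product, and_iff_right_iff_imp]
    intro H hs
    have := hs.minimalPeriod_eq
    omega
  rw [hS, card_union_of_disjoint, card_product, card_product, ← mul_count_parts_partition,
    ← mul_count_parts_partition] at key
  · linarith
  · rw [disjoint_left]
    rintro ⟨a, b⟩ h1 h2
    simp only [S, mem_filter_univ, mem_product] at h1 h2
    omega

theorem Equiv.Perm.two_mul_card_isSwap_join_self (h : Perm α) {i : ℕ} (hi : 0 < i) :
    2 * Nat.card {t : Perm α // t.IsSwap ∧
        (t * h).partition.parts = h.partition.parts - {i, i} + {i + i}} =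
      i ^ 2 * h.partition.parts.count i * (h.partition.parts.count i - 1) := by
  rw [h.two_mul_card_isSwap_join hi hi]
  simp only [or_self]
  rw [card_eq_sum_card_fiberwise (f := Prod.fst)
    (t := ({x | minimalPeriod h x = i} : Finset α))]
  · rw [sum_const_nat (m := i * (h.partition.parts.count i - 1)), ← mul_count_parts_partition]
    · ring
    · intro a ha
      rw [mem_filter_univ] at ha
      have : ({ab ∈ ({ab : α × α | ¬ h.SameCycle ab.1 ab.2 ∧
          (minimalPeriod h ab.1 = i ∧ minimalPeriod h ab.2 = i)} : Finset (α × α)) |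
            ab.1 = a} : Finset (α × α)) =
          (({x | minimalPeriod h x = i} : Finset α) \ ({x | h.SameCycle a x} : Finset α)).map
            ⟨Prod.mk a, Prod.mk_right_injective a⟩ := by
        ext ⟨c, e⟩
        simp only [mem_filter, mem_univ, true_and, mem_map, mem_sdiff, Embedding.coeFn_mk,
          Prod.mk.injEq]
        grind
      rw [this, card_map, card_sdiff_of_subset, h.card_filter_sameCycle, ha,
        ← mul_count_parts_partition, Nat.mul_sub, mul_one]
      intro x hx
      rw [mem_filter_univ] at hx ⊢
      rw [hx.minimalPeriod_eq, ha]
  · intro ab hab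
    simp only [coe_filter, mem_univ, true_and, Set.mem_ofPred_eq] at hab ⊢
    exact hab.2.1

theorem Equiv.Perm.card_filter_period_iterate (h : Perm α) (m i : ℕ) :
    #{ab : α × α | minimalPeriod h ab.1 = m ∧ ab.2 = h^[i] ab.1} =
      m * h.partition.parts.count m := by
  rw [mul_count_parts_partition]
  refine card_bij' (fun ab _ ↦ ab.1) (fun a _ ↦ (a, h^[i] a)) ?_ ?_ ?_ ?_ <;>
  simp +contextual [Prod.ext_iff]

theorem Equiv.Perm.card_isSwap_cut_of_ne (h : Perm α) {i j : ℕ} (hi : 0 < i) (hj : 0 < j)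
    (hij : i ≠ j) :
    Nat.card {t : Perm α // t.IsSwap ∧
        (t * h).partition.parts = h.partition.parts - {i + j} + {i, j}} =
      (i + j) * h.partition.parts.count (i + j) := by
  have key := h.two_mul_card_isSwap_cut hi hj
  simp only [and_or_left] at key
  rw [filter_or, card_union_of_disjoint, card_filter_period_iterate,
    card_filter_period_iterate] at key
  · omega
  · rw [disjoint_left]
    rintro ⟨a, b⟩ h1 h2
    simp only [mem_filter_univ] at h1 h2
    exact hij (iterate_injOn_Iio_minimalPeriod (f := h) (x := a) (Set.mem_Iio.2 (by omega))
      (Set.mem_Iio.2 (by omega)) (h1.2.symm.trans h2.2))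

theorem Equiv.Perm.card_isSwap_cut_self (h : Perm α) {i : ℕ} (hi : 0 < i) :
    Nat.card {t : Perm α // t.IsSwap ∧
        (t * h).partition.parts = h.partition.parts - {i + i} + {i, i}} =
      i * h.partition.parts.count (i + i) := by
  have key := h.two_mul_card_isSwap_cut hi hi
  simp only [or_self] at key
  rw [card_filter_period_iterate] at key
  linarith

end Counting

theorem fullCT_eq_parts_partition (d : ℕ) (g : Equiv.Perm (Fin d)) :
    fullCT d g = g.partition.parts := by
  rw [fullCT, Perm.parts_partition, Perm.sum_cycleType, Fintype.card_fin]

/-- Multiplying a permutation `h` of cycle type `μ` by the class of transpositions: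
the number of transpositions `t` such that `t·h` has the cycle type obtained from `μ`
by joining an `i`-cycle and a `j`-cycle (`i < j`) is `i·j·mᵢ(μ)·mⱼ(μ)`; by joining two
`i`-cycles it is `i²mᵢ(μ)(mᵢ(μ)-1)/2`; by cutting an `(i+j)`-cycle into an `i`-cycle
and a `j`-cycle (`i < j`) it is `(i+j)·m_{i+j}(μ)`; and by cutting a `2i`-cycle into
two `i`-cycles it is `i·m_{2i}(μ)`. -/
theorem cut_and_join_counts (d : ℕ) (h : Equiv.Perm (Fin d)) (i j : ℕ)
    (hi : 1 ≤ i) (hj : 1 ≤ j) :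
    (i < j →
      Nat.card {t : Equiv.Perm (Fin d) // t.IsSwap ∧
          fullCT d (t * h) = fullCT d h - {i, j} + {i + j}}
        = i * j * (fullCT d h).count i * (fullCT d h).count j)
    ∧ (i < j →
      Nat.card {t : Equiv.Perm (Fin d) // t.IsSwap ∧
          fullCT d (t * h) = fullCT d h - {i + j} + {i, j}}
        = (i + j) * (fullCT d h).count (i + j))
    ∧ 2 * Nat.card {t : Equiv.Perm (Fin d) // t.IsSwap ∧
          fullCT d (t * h) = fullCT d h - {i, i} + {2 * i}}
        = i ^ 2 * (fullCT d h).count i * ((fullCT d h).count i - 1)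
    ∧ Nat.card {t : Equiv.Perm (Fin d) // t.IsSwap ∧
          fullCT d (t * h) = fullCT d h - {2 * i} + {i, i}}
        = i * (fullCT d h).count (2 * i) := by
  simp only [fullCT_eq_parts_partition, two_mul i]
  exact ⟨fun hij ↦ h.card_isSwap_join_of_ne hi hj hij.ne,
    fun hij ↦ h.card_isSwap_cut_of_ne hi hj hij.ne,
    h.two_mul_card_isSwap_join_self hi, h.card_isSwap_cut_self hi⟩
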